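/- arXiv:2102.05179 — 7 statements merged into one kernel-verified Lean document; each statement's English description precedes it below -/
import Mathlib

section
/- Let L̂ be a real symmetric positive semidefinite n×n matrix whose kernel is the one-dimensional span of a nonzero vector υ̂ ∈ ℝⁿ. Let V be a real n×r matrix with linearly independent columns such that υ̂ lies in the column space of V. Then VᵀL̂V is symmetric positive semidefinite and its kernel is one-dimensional; it is spanned by the unique w ∈ ℝʳ with Vw = υ̂. -/
open Matrix

/-- The kernel of the congruence `VᵀAV` of a real PSD matrix `A` is the preimage under `V` of the
kernel of `A`. -/
theorem Matrix.PosSemidef.ker_transpose_mul_mul_same {m k : Type*} [Fintype m] [Fintype k]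
    {A : Matrix m m ℝ} (hA : A.PosSemidef) (V : Matrix m k ℝ) :
    LinearMap.ker (Vᵀ * A * V).mulVecLin = (LinearMap.ker A.mulVecLin).comap V.mulVecLin := by
  ext x
  simp only [LinearMap.mem_ker, Submodule.mem_comap, mulVecLin_apply, ← mulVec_mulVec]
  refine ⟨fun h => ?_, fun h => by rw [h, mulVec_zero]⟩
  rw [← hA.dotProduct_mulVec_zero_iff, star_trivial]
  calc V *ᵥ x ⬝ᵥ A *ᵥ V *ᵥ x = x ⬝ᵥ Vᵀ *ᵥ A *ᵥ V *ᵥ x := by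
        rw [dotProduct_mulVec x Vᵀ, vecMul_transpose]
    _ = 0 := by rw [h, dotProduct_zero]

/-- If `L̂` is PSD with kernel spanned by `υ̂ ≠ 0`, and `V` has linearly independent
columns with `υ̂` in its column space, then `VᵀL̂V` is PSD and its kernel is the
one-dimensional span of the unique `w` with `Vw = υ̂`. -/
theorem stmt2 {n r : ℕ} (Lhat : Matrix (Fin n) (Fin n) ℝ) (hL : Lhat.PosSemidef)
    (vhat : Fin n → ℝ) (hv0 : vhat ≠ 0)
    (hker : LinearMap.ker Lhat.mulVecLin = Submodule.span ℝ {vhat})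
    (V : Matrix (Fin n) (Fin r) ℝ) (hVinj : Function.Injective V.mulVecLin)
    (hrange : vhat ∈ LinearMap.range V.mulVecLin) :
    (Vᵀ * Lhat * V).PosSemidef ∧
    (∃! w : Fin r → ℝ, V.mulVec w = vhat) ∧
    (∀ w : Fin r → ℝ, V.mulVec w = vhat →
      LinearMap.ker (Vᵀ * Lhat * V).mulVecLin = Submodule.span ℝ {w}) := by
  refine ⟨by simpa only [conjTranspose_eq_transpose_of_trivial] using
    hL.conjTranspose_mul_mul_same V, ?_, fun w hw => ?_⟩
  · obtain ⟨w, hw⟩ := hrange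
    exact ⟨w, hw, fun y hy => hVinj (hy.trans hw.symm)⟩
  · have hspan : Submodule.span ℝ {vhat} = (Submodule.span ℝ {w}).map V.mulVecLin := by
      rw [Submodule.map_span, Set.image_singleton, mulVecLin_apply, hw]
    rw [hL.ker_transpose_mul_mul_same, hker, hspan, Submodule.comap_map_eq_of_injective hVinj]
end

section
/- Let V be a real n×r matrix with orthonormal columns (VᵀV = I_r), let υ̂ ∈ ℝⁿ lie in the column space of V (equivalently VVᵀυ̂ = υ̂), let D be a real n×n matrix with α := υ̂ᵀDυ̂ ≠ 0, and let B ∈ ℝ^{n×m}, C ∈ ℝ^{q×n}. Then α_r := υ̂ᵀ V (VᵀDV) Vᵀ υ̂ = υ̂ᵀDυ̂ = α, and the reduced residue matrix φ₀ᵣ := α_r⁻¹ (CV)(Vᵀυ̂)(υ̂ᵀV)(VᵀB) equals the full residue matrix φ₀ := α⁻¹ C υ̂ υ̂ᵀ B. -/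
open Matrix

/-- A matrix with orthonormal columns fixes its column space under `V Vᵀ`. -/
theorem mulVec_transpose_mulVec_of_mem_range {ι κ R : Type*} [Fintype ι] [Fintype κ]
    [DecidableEq κ] [CommSemiring R] {V : Matrix ι κ R} (hV : Vᵀ * V = 1) {x : ι → R}
    (hx : x ∈ LinearMap.range V.mulVecLin) : V *ᵥ (Vᵀ *ᵥ x) = x := by
  obtain ⟨y, rfl⟩ := hx
  simp only [mulVecLin_apply, mulVec_mulVec, hV, Matrix.mul_one]

/-- If `V` has orthonormal columns and `υ̂` lies in its column space, then the reduced
quantity `α_r = υ̂ᵀV(VᵀDV)Vᵀυ̂` equals `α = υ̂ᵀDυ̂`, and the reduced residue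
`φ₀ᵣ = α_r⁻¹ (CV)(Vᵀυ̂)(υ̂ᵀV)(VᵀB)` equals the full residue `φ₀ = α⁻¹ C υ̂ υ̂ᵀ B`. -/
theorem stmt10 {n r m q : ℕ} (V : Matrix (Fin n) (Fin r) ℝ)
    (hV : Vᵀ * V = (1 : Matrix (Fin r) (Fin r) ℝ))
    (vhat : Fin n → ℝ) (hrange : vhat ∈ LinearMap.range V.mulVecLin)
    (D : Matrix (Fin n) (Fin n) ℝ) (hα : vhat ⬝ᵥ D.mulVec vhat ≠ 0)
    (B : Matrix (Fin n) (Fin m) ℝ) (C : Matrix (Fin q) (Fin n) ℝ) :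
    vhat ⬝ᵥ (V * (Vᵀ * D * V) * Vᵀ).mulVec vhat = vhat ⬝ᵥ D.mulVec vhat ∧
    (vhat ⬝ᵥ (V * (Vᵀ * D * V) * Vᵀ).mulVec vhat)⁻¹ •
        ((C * V) * Matrix.vecMulVec (Vᵀ.mulVec vhat) (Vᵀ.mulVec vhat) * (Vᵀ * B))
      = (vhat ⬝ᵥ D.mulVec vhat)⁻¹ • (C * Matrix.vecMulVec vhat vhat * B) := by
  have hP := mulVec_transpose_mulVec_of_mem_range hV hrange
  have hscalar : vhat ⬝ᵥ (V * (Vᵀ * D * V) * Vᵀ).mulVec vhat = vhat ⬝ᵥ D.mulVec vhat := by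
    simp only [← mulVec_mulVec, hP]
    rw [dotProduct_mulVec, dotProduct_mulVec, vecMul_vecMul, ← mulVec_transpose,
      transpose_mul, transpose_transpose, ← mulVec_mulVec, hP]
  have houter : V * vecMulVec (Vᵀ *ᵥ vhat) (Vᵀ *ᵥ vhat) * Vᵀ = vecMulVec vhat vhat := by
    rw [mul_vecMulVec, vecMulVec_mul, vecMul_transpose, hP]
  refine ⟨hscalar, ?_⟩
  rw [hscalar, ← houter]
  simp only [Matrix.mul_assoc]
end

section
/- Let M and D be real symmetric positive definite n×n matrices, L̂ a real symmetric positive semidefinite n×n matrix whose kernel is the one-dimensional span of a nonzero vector υ̂ ∈ ℝⁿ, B ∈ ℝ^{n×m}, and C ∈ ℝ^{q×n}. Then there is a punctured neighborhood of 0 in ℂ on which s²M + sD + L̂ (regarded as a complex matrix) is invertible, and s·H(s) = s·C(s²M + sD + L̂)⁻¹B converges to the matrix φ₀ := (υ̂ᵀDυ̂)⁻¹ C υ̂ υ̂ᵀ B as s → 0 with s ≠ 0. That is, H has a simple pole at s = 0 with residue φ₀. -/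
open Matrix Filter Topology

/-- If `R * D * R = R`, `R` is annihilated by `L` on both sides and `L + D * R * D` is
invertible, then `s²M + sD + L` is invertible near `s = 0`, `s ≠ 0`, and its inverse has at worst
a simple pole at `0`, with residue `R`. -/
theorem tendsto_smul_inv_pencil {n : ℕ} (M D L R : Matrix (Fin n) (Fin n) ℂ)
    (hLR : L * R = 0) (hRL : R * L = 0) (hR : R * D * R = R)
    (hU : IsUnit (L + D * R * D)) :
    (∀ᶠ s in 𝓝[≠] (0 : ℂ), IsUnit (s ^ 2 • M + s • D + L)) ∧
      Tendsto (fun s : ℂ => s • (s ^ 2 • M + s • D + L)⁻¹) (𝓝[≠] 0) (𝓝 R) := by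
  let N : ℂ → Matrix (Fin n) (Fin n) ℂ := fun s =>
    (s ^ 2 • M + s • D + L) * (1 - R * D) + (D + s • M) * (R * D)
  have hNc : Continuous N := by fun_prop
  have hN0 : N 0 = L + D * R * D := by
    have : L * (R * D) = 0 := by rw [← mul_assoc, hLR, zero_mul]
    simp [N, mul_sub, this, mul_assoc]
  have hP : (R * D) * (R * D) = R * D := by rw [← mul_assoc, hR]
  have hdet : (N 0).det ≠ 0 := by
    rw [hN0]; exact ((Matrix.isUnit_iff_isUnit_det _).1 hU).ne_zero
  have hev : ∀ᶠ s in 𝓝[≠] (0 : ℂ), (N s).det ≠ 0 :=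
    (hNc.matrix_det.continuousAt.eventually_ne hdet).filter_mono nhdsWithin_le_nhds
  have hinv : ∀ᶠ s in 𝓝[≠] (0 : ℂ),
      (s ^ 2 • M + s • D + L) * ((1 - R * D + s⁻¹ • (R * D)) * (N s)⁻¹) = 1 := by
    filter_upwards [hev, self_mem_nhdsWithin] with s hs hs0
    have hs0 : s ≠ 0 := hs0
    have hKN : (s ^ 2 • M + s • D + L) * (1 - R * D + s⁻¹ • (R * D)) = N s := by
      have : (s ^ 2 • M + s • D + L) * (s⁻¹ • (R * D)) = (D + s • M) * (R * D) := by
        have h0 : L * (R * D) = 0 := by rw [← mul_assoc, hLR, zero_mul]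
        simp only [add_mul, mul_smul_comm, smul_mul_assoc, h0, add_zero, smul_add, smul_smul]
        rw [inv_mul_cancel₀ hs0, one_smul, add_comm, pow_two, inv_mul_cancel_left₀ hs0]
      rw [mul_add, this]
    rw [← mul_assoc, hKN, Matrix.mul_nonsing_inv _ (isUnit_iff_ne_zero.2 hs)]
  refine ⟨hinv.mono fun s hs => IsUnit.of_mul_eq_one _ hs, ?_⟩
  have hlim : Tendsto (fun s : ℂ => (s • (1 - R * D) + R * D) * (N s)⁻¹) (𝓝[≠] 0) (𝓝 R) := by
    have hc : ContinuousAt (fun s : ℂ => (s • (1 - R * D) + R * D) * (N s)⁻¹) 0 := by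
      have h1 : ContinuousAt (fun s => (N s)⁻¹) 0 := by
        simp only [Matrix.inv_def, Ring.inverse_eq_inv']
        exact (hNc.matrix_det.continuousAt.inv₀ hdet).smul hNc.matrix_adjugate.continuousAt
      exact ContinuousAt.mul (by fun_prop) h1
    have hval : (((0 : ℂ) • (1 - R * D) + R * D) * (N 0)⁻¹) = R := by
      have : R * D = R * N 0 := by
        rw [hN0, mul_add, hRL, zero_add, ← mul_assoc, ← mul_assoc, hR]
      rw [zero_smul, zero_add, this, mul_assoc,
        Matrix.mul_nonsing_inv _ (isUnit_iff_ne_zero.2 hdet), mul_one]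
    have := hc.tendsto
    rw [hval] at this
    exact this.mono_left nhdsWithin_le_nhds
  refine hlim.congr' ?_
  filter_upwards [hinv, self_mem_nhdsWithin] with s hs hs0
  have hs0 : s ≠ 0 := hs0
  rw [Matrix.inv_eq_right_inv hs, ← smul_mul_assoc, smul_add, smul_smul, mul_inv_cancel₀ hs0,
    one_smul]

/-- If the kernel of `L` is spanned by `v` and `R * D` fixes `v`, then `L + D * R * D` is
invertible. -/
theorem isUnit_add_mul_mul {n : ℕ} {D L R : Matrix (Fin n) (Fin n) ℝ} {v : Fin n → ℝ}
    (hRL : R * L = 0) (hR : R * D * R = R) (hRDv : (R * D) *ᵥ v = v)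
    (hker : LinearMap.ker L.mulVecLin = Submodule.span ℝ {v}) :
    IsUnit (L + D * R * D) := by
  rw [← Matrix.mulVec_injective_iff_isUnit]
  refine (injective_iff_map_eq_zero (L + D * R * D).mulVecLin).2 fun x hx => ?_
  rw [mulVecLin_apply] at hx
  have hRDx : (R * D) *ᵥ x = 0 := by
    have : R * (L + D * R * D) = R * D := by
      rw [mul_add, hRL, zero_add, ← mul_assoc, ← mul_assoc, hR]
    rw [← this, ← mulVec_mulVec, hx, mulVec_zero]
  have hLx : L *ᵥ x = 0 := by
    rwa [add_mulVec, mul_assoc, ← mulVec_mulVec, hRDx, mulVec_zero, add_zero] at hx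
  have hmem : x ∈ Submodule.span ℝ {v} := by
    rw [← hker]; simpa using hLx
  obtain ⟨c, rfl⟩ := Submodule.mem_span_singleton.1 hmem
  rwa [mulVec_smul, hRDv] at hRDx

/-- For `M, D` symmetric positive definite and `L̂` symmetric positive semidefinite with
kernel spanned by `υ̂ ≠ 0`, the pencil `s²M + sD + L̂` is invertible on a punctured
neighborhood of `0`, and `s·H(s) = s·C(s²M + sD + L̂)⁻¹B → φ₀ = (υ̂ᵀDυ̂)⁻¹ C υ̂ υ̂ᵀ B`
as `s → 0`, `s ≠ 0`: `H` has a simple pole at `0` with residue `φ₀`. -/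
theorem stmt11 {n m q : ℕ} (M D Lhat : Matrix (Fin n) (Fin n) ℝ)
    (hM : M.PosDef) (hD : D.PosDef) (hL : Lhat.PosSemidef)
    (vhat : Fin n → ℝ) (hv0 : vhat ≠ 0)
    (hker : LinearMap.ker Lhat.mulVecLin = Submodule.span ℝ {vhat})
    (B : Matrix (Fin n) (Fin m) ℝ) (C : Matrix (Fin q) (Fin n) ℝ) :
    letI K : ℂ → Matrix (Fin n) (Fin n) ℂ := fun s =>
      s ^ 2 • M.map (Complex.ofReal ·) + s • D.map (Complex.ofReal ·)
        + Lhat.map (Complex.ofReal ·)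
    letI H : ℂ → Matrix (Fin q) (Fin m) ℂ := fun s =>
      C.map (Complex.ofReal ·) * (K s)⁻¹ * B.map (Complex.ofReal ·)
    letI φ₀ : Matrix (Fin q) (Fin m) ℂ :=
      ((vhat ⬝ᵥ D.mulVec vhat)⁻¹ • (C * Matrix.vecMulVec vhat vhat * B)).map
        (Complex.ofReal ·)
    (∃ ε > (0 : ℝ), ∀ s : ℂ, s ≠ 0 → ‖s‖ < ε → IsUnit (K s)) ∧
    Tendsto (fun s : ℂ => s • H s) (𝓝[≠] 0) (𝓝 φ₀) := by
  have hd : vhat ⬝ᵥ D *ᵥ vhat ≠ 0 := by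
    simpa using (hD.dotProduct_mulVec_pos hv0).ne'
  have hLv : Lhat *ᵥ vhat = 0 := by
    have : vhat ∈ LinearMap.ker Lhat.mulVecLin := by
      rw [hker]; exact Submodule.mem_span_singleton_self vhat
    simpa using this
  have hvL : vhat ᵥ* Lhat = 0 := by
    have hT : Lhatᵀ = Lhat := by simpa using hL.isHermitian.eq
    rw [← hT, vecMul_transpose, hLv]
  set R : Matrix (Fin n) (Fin n) ℝ := (vhat ⬝ᵥ D *ᵥ vhat)⁻¹ • vecMulVec vhat vhat with hRdef
  have hLR : Lhat * R = 0 := by simp [hRdef, mul_vecMulVec, hLv]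
  have hRL : R * Lhat = 0 := by simp [hRdef, vecMulVec_mul, hvL]
  have hRDv : (R * D) *ᵥ vhat = vhat := by
    rw [← mulVec_mulVec, hRdef, smul_mulVec, vecMulVec_mulVec, op_smul_eq_smul, smul_smul,
      inv_mul_cancel₀ hd, one_smul]
  have hR : R * D * R = R := by
    have h : R * D * vecMulVec vhat vhat = vecMulVec vhat vhat := by rw [mul_vecMulVec, hRDv]
    nth_rw 2 [hRdef]
    rw [mul_smul_comm, h]
  have hU := isUnit_add_mul_mul hRL hR hRDv hker
  let F : Matrix (Fin n) (Fin n) ℝ →+* Matrix (Fin n) (Fin n) ℂ := Complex.ofRealHom.mapMatrix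
  obtain ⟨hunit, hlim⟩ := tendsto_smul_inv_pencil (F M) (F D) (F Lhat) (F R)
    (by rw [← map_mul, hLR, map_zero]) (by rw [← map_mul, hRL, map_zero])
    (by rw [← map_mul, ← map_mul, hR])
    (by rw [← map_mul, ← map_mul, ← map_add]; exact hU.map F)
  refine ⟨?_, ?_⟩
  · rw [eventually_nhdsWithin_iff, Metric.eventually_nhds_iff] at hunit
    obtain ⟨ε, hε, h⟩ := hunit
    exact ⟨ε, hε, fun s hs0 hs => h (by simpa using hs) hs0⟩
  · have hφ : ((vhat ⬝ᵥ D *ᵥ vhat)⁻¹ • (C * vecMulVec vhat vhat * B)).map (Complex.ofReal ·) =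
        C.map (Complex.ofReal ·) * F R * B.map (Complex.ofReal ·) := by
      rw [← Matrix.smul_mul, ← Matrix.mul_smul, ← hRdef]
      exact (Matrix.map_mul (f := Complex.ofRealHom)).trans
        (congrArg (· * _) (Matrix.map_mul (f := Complex.ofRealHom)))
    rw [hφ]
    have hcont : Continuous fun X : Matrix (Fin n) (Fin n) ℂ =>
        C.map (Complex.ofReal ·) * X * B.map (Complex.ofReal ·) := by fun_prop
    refine ((hcont.tendsto _).comp hlim).congr fun s => ?_
    rw [Function.comp_apply, Matrix.mul_smul, Matrix.smul_mul]
    rfl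
end

section
/- (Theorem 1) Let M and D be real symmetric positive definite n×n matrices, L̂ a real symmetric positive semidefinite n×n matrix whose kernel is the one-dimensional span of a nonzero vector υ̂ ∈ ℝⁿ, B ∈ ℝ^{n×m}, C ∈ ℝ^{q×n}, and let V be a real n×r matrix with orthonormal columns (VᵀV = I_r) such that υ̂ lies in the column space of V. Define M_r = VᵀMV, D_r = VᵀDV, L_r = VᵀL̂V, B_r = VᵀB, C_r = CV and H_r(s) = C_r(s²M_r + sD_r + L_r)⁻¹B_r. Then there is a punctured neighborhood of 0 in ℂ on which s²M_r + sD_r + L_r is invertible, and s·H_r(s) converges to φ₀ := (υ̂ᵀDυ̂)⁻¹ C υ̂ υ̂ᵀ B as s → 0 with s ≠ 0; i.e. the reduced model retains the simple pole of the full model at zero and its residue. -/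
open Matrix Filter Topology

/-- If `L * E = 0`, `P * (D * E + L) = E` and `D * E + L` is invertible, then the quadratic pencil
`s² M + s D + L` is invertible for small `s ≠ 0`, and its inverse has residue `P` at zero. -/
theorem Matrix.quadraticPencil_residue {ι : Type*} [Fintype ι] [DecidableEq ι]
    {M D L E P : Matrix ι ι ℂ} (hLE : L * E = 0) (hP : P * (D * E + L) = E)
    (hG : IsUnit (D * E + L)) :
    (∀ᶠ s : ℂ in 𝓝[≠] 0, IsUnit (s ^ 2 • M + s • D + L)) ∧
      Tendsto (fun s : ℂ => s • (s ^ 2 • M + s • D + L)⁻¹) (𝓝[≠] 0) (𝓝 P) := by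
  set G : ℂ → Matrix ι ι ℂ := fun s =>
    D * E + L + s • (M * E + D * (1 - E)) + s ^ 2 • (M * (1 - E)) with hGdef
  have hG0 : G 0 = D * E + L := by simp [hGdef]
  have hGcont : Continuous G := by fun_prop
  have hdet : (G 0).det ≠ 0 := by
    rw [hG0]
    exact ((Matrix.isUnit_iff_isUnit_det _).1 hG).ne_zero
  have hGunit : ∀ᶠ s in 𝓝[≠] (0 : ℂ), (G s).det ≠ 0 :=
    (hGcont.matrix_det.continuousAt.eventually_ne hdet).filter_mono nhdsWithin_le_nhds
  have hfac : ∀ s : ℂ, (s ^ 2 • M + s • D + L) * (E + s • (1 - E)) = s • G s := by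
    intro s
    simp only [hGdef, add_mul, mul_add, mul_sub, smul_mul_assoc, mul_smul_comm, hLE, mul_one,
      smul_add, smul_sub, smul_smul]
    module
  have hinv : ∀ᶠ s in 𝓝[≠] (0 : ℂ),
      (s ^ 2 • M + s • D + L) * (s⁻¹ • ((E + s • (1 - E)) * (G s)⁻¹)) = 1 := by
    filter_upwards [hGunit, self_mem_nhdsWithin] with s hs hs0
    rw [mul_smul_comm, ← mul_assoc, hfac, smul_mul_assoc,
      Matrix.mul_nonsing_inv _ (isUnit_iff_ne_zero.2 hs), smul_smul, inv_mul_cancel₀ hs0, one_smul]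
  refine ⟨hinv.mono fun s hs => IsUnit.of_mul_eq_one _ hs, ?_⟩
  have hlim : Tendsto (fun s : ℂ => (E + s • (1 - E)) * (G s)⁻¹) (𝓝[≠] 0) (𝓝 P) := by
    have hGi : ContinuousAt (fun s => (G s)⁻¹) 0 := by
      simp only [Matrix.inv_def, Ring.inverse_eq_inv']
      exact (hGcont.matrix_det.continuousAt.inv₀ hdet).smul
        hGcont.matrix_adjugate.continuousAt
    have hE : ContinuousAt (fun s : ℂ => E + s • (1 - E)) 0 := by fun_prop
    have hprod : Tendsto (fun s : ℂ => (E + s • (1 - E)) * (G s)⁻¹) (𝓝 0)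
        (𝓝 ((E + (0 : ℂ) • (1 - E)) * (G 0)⁻¹)) := hE.mul hGi
    have hval : (E + (0 : ℂ) • (1 - E)) * (G 0)⁻¹ = P := by
      rw [zero_smul, add_zero, ← hP, ← hG0, mul_assoc,
        Matrix.mul_nonsing_inv _ (isUnit_iff_ne_zero.2 hdet), mul_one]
    rw [hval] at hprod
    exact hprod.mono_left nhdsWithin_le_nhds
  refine hlim.congr' ?_
  filter_upwards [hinv, self_mem_nhdsWithin] with s hs hs0
  rw [Matrix.inv_eq_right_inv hs, smul_smul, mul_inv_cancel₀ hs0, one_smul]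

/-- If the kernel of a symmetric matrix `L` lies in the line through `w` and `wᵀ D w ≠ 0`, then
the rank-one perturbation `L + (wᵀ D w)⁻¹ D w wᵀ D` is invertible. -/
theorem Matrix.isUnit_rankOne_add {ι : Type*} [Fintype ι] [DecidableEq ι]
    {D L : Matrix ι ι ℝ} {w : ι → ℝ} (hd : w ⬝ᵥ D *ᵥ w ≠ 0)
    (hwL : w ᵥ* L = 0) (hker : ∀ x, L *ᵥ x = 0 → ∃ c : ℝ, x = c • w) :
    IsUnit (D * ((w ⬝ᵥ D *ᵥ w)⁻¹ • (vecMulVec w w * D)) + L) := by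
  rw [← Matrix.mulVec_injective_iff_isUnit, ← Matrix.coe_mulVecLin, injective_iff_map_eq_zero]
  intro x hx
  have hexp : (w ⬝ᵥ D *ᵥ w)⁻¹ • (w ⬝ᵥ D *ᵥ x) • D *ᵥ w + L *ᵥ x = 0 := by
    rw [Matrix.mulVecLin_apply, add_mulVec, ← mulVec_mulVec, smul_mulVec, ← mulVec_mulVec,
      vecMulVec_mulVec, mulVec_smul] at hx
    simpa [mulVec_smul] using hx
  have hwx : w ⬝ᵥ D *ᵥ x = 0 := by
    have h := congrArg (w ⬝ᵥ ·) hexp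
    simp only [dotProduct_add, dotProduct_smul, dotProduct_mulVec w L, hwL, zero_dotProduct,
      dotProduct_zero, add_zero, smul_eq_mul] at h
    simpa [hd] using h
  rw [hwx, zero_smul, smul_zero, zero_add] at hexp
  obtain ⟨c, rfl⟩ := hker x hexp
  rw [mulVec_smul, dotProduct_smul, smul_eq_mul] at hwx
  rw [(mul_eq_zero.1 hwx).resolve_right hd, zero_smul]

/-- (Theorem 1) If the model reduction basis `V` has orthonormal columns and `υ̂` (the
kernel direction of `L̂`) lies in its column space, then the Galerkin-reduced transfer
function `H_r(s) = CV(s²Mᵣ + sDᵣ + Lᵣ)⁻¹VᵀB` retains the simple pole of the full model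
at zero and its residue: `s·H_r(s) → φ₀ = (υ̂ᵀDυ̂)⁻¹ C υ̂ υ̂ᵀ B` as `s → 0`, `s ≠ 0`. -/
theorem stmt12 {n m q r : ℕ} (M D Lhat : Matrix (Fin n) (Fin n) ℝ)
    (hM : M.PosDef) (hD : D.PosDef) (hL : Lhat.PosSemidef)
    (vhat : Fin n → ℝ) (hv0 : vhat ≠ 0)
    (hker : LinearMap.ker Lhat.mulVecLin = Submodule.span ℝ {vhat})
    (B : Matrix (Fin n) (Fin m) ℝ) (C : Matrix (Fin q) (Fin n) ℝ)
    (V : Matrix (Fin n) (Fin r) ℝ) (hV : Vᵀ * V = (1 : Matrix (Fin r) (Fin r) ℝ))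
    (hrange : vhat ∈ LinearMap.range V.mulVecLin) :
    letI Kr : ℂ → Matrix (Fin r) (Fin r) ℂ := fun s =>
      s ^ 2 • (Vᵀ * M * V).map (Complex.ofReal ·) + s • (Vᵀ * D * V).map (Complex.ofReal ·)
        + (Vᵀ * Lhat * V).map (Complex.ofReal ·)
    letI Hr : ℂ → Matrix (Fin q) (Fin m) ℂ := fun s =>
      (C * V).map (Complex.ofReal ·) * (Kr s)⁻¹ * (Vᵀ * B).map (Complex.ofReal ·)
    letI φ₀ : Matrix (Fin q) (Fin m) ℂ :=
      ((vhat ⬝ᵥ D.mulVec vhat)⁻¹ • (C * Matrix.vecMulVec vhat vhat * B)).map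
        (Complex.ofReal ·)
    (∃ ε > (0 : ℝ), ∀ s : ℂ, s ≠ 0 → ‖s‖ < ε → IsUnit (Kr s)) ∧
    Tendsto (fun s : ℂ => s • Hr s) (𝓝[≠] 0) (𝓝 φ₀) := by
  obtain ⟨w, rfl⟩ := hrange
  simp only [mulVecLin_apply] at hv0 hker ⊢
  have hVinj : Function.Injective V.mulVec := fun x y hxy => by
    simpa [mulVec_mulVec, hV] using congrArg (Vᵀ *ᵥ ·) hxy
  have hLw : Lhat *ᵥ (V *ᵥ w) = 0 := by
    have : V *ᵥ w ∈ LinearMap.ker Lhat.mulVecLin := hker ▸ Submodule.mem_span_singleton_self _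
    simpa using this
  have hLT : Lhatᵀ = Lhat := by simpa using hL.isHermitian.eq
  set Dr := Vᵀ * D * V with hDr
  set Lr := Vᵀ * Lhat * V with hLr
  have hform : ∀ (A : Matrix (Fin n) (Fin n) ℝ) (x : Fin r → ℝ),
      x ⬝ᵥ (Vᵀ * A * V) *ᵥ x = V *ᵥ x ⬝ᵥ A *ᵥ (V *ᵥ x) := fun A x => by
    rw [← mulVec_mulVec, ← mulVec_mulVec, dotProduct_mulVec, vecMul_transpose]
  have hdr : w ⬝ᵥ Dr *ᵥ w = V *ᵥ w ⬝ᵥ D *ᵥ (V *ᵥ w) := hform D w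
  have hd : w ⬝ᵥ Dr *ᵥ w ≠ 0 := by
    rw [hdr]
    simpa using (hD.dotProduct_mulVec_pos hv0).ne'
  have hLrw : Lr *ᵥ w = 0 := by
    rw [hLr, ← mulVec_mulVec, ← mulVec_mulVec, hLw, mulVec_zero]
  have hwLr : w ᵥ* Lr = 0 := by
    rw [← mulVec_transpose, hLr, transpose_mul, transpose_mul, transpose_transpose, hLT,
      ← Matrix.mul_assoc, ← hLr, hLrw]
  have hkerr : ∀ x, Lr *ᵥ x = 0 → ∃ c : ℝ, x = c • w := by
    intro x hx
    have hquad : star (V *ᵥ x) ⬝ᵥ Lhat *ᵥ (V *ᵥ x) = 0 := by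
      rw [star_trivial, ← hform, ← hLr, hx, dotProduct_zero]
    have hmem : V *ᵥ x ∈ LinearMap.ker Lhat.mulVecLin :=
      (hL.dotProduct_mulVec_zero_iff _).1 hquad
    rw [hker, Submodule.mem_span_singleton] at hmem
    obtain ⟨c, hc⟩ := hmem
    exact ⟨c, hVinj (by rw [← hc, mulVec_smul])⟩
  have hunit := isUnit_rankOne_add hd hwLr hkerr
  set P := (w ⬝ᵥ Dr *ᵥ w)⁻¹ • vecMulVec w w with hP
  set E := (w ⬝ᵥ Dr *ᵥ w)⁻¹ • (vecMulVec w w * Dr) with hE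
  have hLE : Lr * E = 0 := by
    rw [hE, mul_smul_comm, ← mul_assoc, mul_vecMulVec, hLrw, zero_vecMulVec, zero_mul, smul_zero]
  have hPDE : P * (Dr * E + Lr) = E := by
    have hPL : P * Lr = 0 := by
      rw [hP, smul_mul_assoc, vecMulVec_mul, hwLr, vecMulVec_zero, smul_zero]
    have hww : vecMulVec w w * (Dr * vecMulVec w w) = (w ⬝ᵥ Dr *ᵥ w) • vecMulVec w w := by
      rw [mul_vecMulVec, vecMulVec_mul_vecMulVec, vecMulVec_smul]
    rw [mul_add, hPL, add_zero, hE, hP, smul_mul_assoc, mul_smul_comm, mul_smul_comm,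
      ← mul_assoc Dr, ← mul_assoc, hww, smul_mul_assoc, inv_smul_smul₀ hd]
  let f : ℝ →+* ℂ := Complex.ofRealHom
  have hmap : ∀ X Y : Matrix (Fin r) (Fin r) ℝ, (X * Y).map f = X.map f * Y.map f :=
    fun X Y => Matrix.map_mul
  have hadd : ∀ X Y : Matrix (Fin r) (Fin r) ℝ, (X + Y).map f = X.map f + Y.map f :=
    fun X Y => Matrix.map_add f (map_add f) X Y
  obtain ⟨hev, hlim⟩ := quadraticPencil_residue (M := (Vᵀ * M * V).map f) (D := Dr.map f)
    (L := Lr.map f) (E := E.map f) (P := P.map f)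
    (by rw [← hmap, hLE]; exact Matrix.map_zero f (map_zero f))
    (by rw [← hmap, ← hadd, ← hmap, hPDE])
    (by rw [← hmap, ← hadd]; exact hunit.map f.mapMatrix)
  constructor
  · rw [eventually_nhdsWithin_iff, Metric.eventually_nhds_iff] at hev
    obtain ⟨ε, hε, h⟩ := hev
    exact ⟨ε, hε, fun s hs0 hs => h (by simpa using hs) hs0⟩
  · have hφ : ((V *ᵥ w ⬝ᵥ D *ᵥ (V *ᵥ w))⁻¹ •
        (C * vecMulVec (V *ᵥ w) (V *ᵥ w) * B)).map f = (C * V).map f * P.map f * (Vᵀ * B).map f := by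
      rw [← Matrix.map_mul, ← Matrix.map_mul]
      congr 1
      rw [hP, hdr, Matrix.mul_smul, Matrix.smul_mul]
      congr 1
      have hVw : vecMulVec (V *ᵥ w) (V *ᵥ w) = V * vecMulVec w w * Vᵀ := by
        rw [mul_vecMulVec, vecMulVec_mul, vecMul_transpose]
      simp only [hVw, Matrix.mul_assoc]
    change Tendsto _ _ (𝓝 (Matrix.map _ f))
    rw [hφ]
    have hcont : Continuous fun X : Matrix (Fin r) (Fin r) ℂ =>
        (C * V).map f * X * (Vᵀ * B).map f := by fun_prop
    refine ((hcont.tendsto _).comp hlim).congr fun s => ?_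
    simp only [Function.comp_apply, Matrix.mul_smul, Matrix.smul_mul]
    rfl
end

section
/- Let M and D be real symmetric positive definite n×n matrices, L̂ a real symmetric positive semidefinite n×n matrix whose kernel is the one-dimensional span of a nonzero vector υ̂ ∈ ℝⁿ, B ∈ ℝ^{n×m}, C ∈ ℝ^{q×n}, and let V be a real n×r matrix with orthonormal columns such that υ̂ lies in the column space of V. Then the error E(s) = H(s) − H_r(s) has a removable singularity at s = 0: there exists a q×m complex matrix E₀ such that E(s) → E₀ as s → 0 with s ≠ 0. -/
open Matrix Filter Topology

/-- If `υ` lies in the left and right kernels of `L` and `L + (D υ)(D υ)ᵀ` is invertible, then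
`(s²M + sD + L)⁻¹` has at most a simple pole at `0`, with residue `υ υᵀ / (υᵀ D υ)`. -/
theorem tendsto_inv_quadratic_pencil_sub_pole {k : ℕ} (M D L : Matrix (Fin k) (Fin k) ℂ)
    (v : Fin k → ℂ) (hD : v ᵥ* D = D *ᵥ v) (hLv : L *ᵥ v = 0) (hvL : v ᵥ* L = 0)
    (hc : v ⬝ᵥ D *ᵥ v ≠ 0) (hdet : (L + vecMulVec (D *ᵥ v) (D *ᵥ v)).det ≠ 0) :
    ∃ E : Matrix (Fin k) (Fin k) ℂ,
      Tendsto (fun s : ℂ => (s ^ 2 • M + s • D + L)⁻¹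
        - (s⁻¹ * (v ⬝ᵥ D *ᵥ v)⁻¹) • vecMulVec v v) (𝓝[≠] 0) (𝓝 E) := by
  set w := D *ᵥ v with hw
  set c := v ⬝ᵥ w with hcdef
  set μ := v ⬝ᵥ M *ᵥ v with hμ
  let G : ℂ → Matrix (Fin k) (Fin k) ℂ := fun s =>
    s ^ 2 • M + s • D + L + vecMulVec w w + s • vecMulVec w (v ᵥ* M)
  let W : ℂ → Matrix (Fin k) (Fin k) ℂ := fun s =>
    (G s)⁻¹ * (1 - c⁻¹ • vecMulVec (s • M *ᵥ v + (1 + μ) • w) v)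
  have hGcont : Continuous G := by fun_prop
  have hG0 : (G 0).det ≠ 0 := by simpa [G] using hdet
  have hinv : ContinuousAt (fun s => (G s)⁻¹) 0 := by
    simp only [Matrix.inv_def, Ring.inverse_eq_inv']
    exact (hGcont.matrix_det.continuousAt.inv₀ hG0).smul hGcont.matrix_adjugate.continuousAt
  have hWcont : ContinuousAt W 0 := by
    refine ContinuousAt.mul hinv (Continuous.continuousAt ?_)
    fun_prop
  refine ⟨W 0, (hWcont.tendsto.mono_left nhdsWithin_le_nhds).congr' ?_⟩
  have hne : ∀ᶠ s in 𝓝[≠] (0 : ℂ), (G s).det ≠ 0 :=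
    (hGcont.matrix_det.continuousAt.eventually_ne hG0).filter_mono nhdsWithin_le_nhds
  filter_upwards [hne, self_mem_nhdsWithin] with s hs hs0
  have hs0 : s ≠ 0 := hs0
  have hu : IsUnit (G s).det := hs.isUnit
  have hfac : (1 + s⁻¹ • vecMulVec w v) * (s ^ 2 • M + s • D + L) = G s := by
    simp only [add_mul, one_mul, smul_mul_assoc, vecMulVec_mul, vecMul_add, vecMul_smul, hD, hvL,
      add_zero, vecMulVec_add, vecMulVec_smul, smul_add, smul_smul, G]
    rw [inv_mul_cancel₀ hs0, show s⁻¹ * s ^ 2 = s by field_simp, one_smul]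
    abel
  have hK : (s ^ 2 • M + s • D + L)⁻¹ = (G s)⁻¹ * (1 + s⁻¹ • vecMulVec w v) := by
    refine Matrix.inv_eq_left_inv ?_
    rw [mul_assoc, hfac, Matrix.nonsing_inv_mul _ hu]
  have hGv : G s *ᵥ v = s ^ 2 • M *ᵥ v + (s + c + s * μ) • w := by
    have h1 : w ⬝ᵥ v = c := dotProduct_comm _ _
    have h2 : (v ᵥ* M) ⬝ᵥ v = μ := (dotProduct_mulVec _ _ _).symm
    simp only [G, add_mulVec, smul_mulVec, vecMulVec_mulVec, h1, h2, hLv, ← hw, op_smul_eq_smul,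
      add_smul, mul_smul]
    abel
  have hpole : vecMulVec v v
      = (G s)⁻¹ * vecMulVec (s ^ 2 • M *ᵥ v + (s + c + s * μ) • w) v := by
    rw [← hGv, ← mul_vecMulVec, ← mul_assoc, Matrix.nonsing_inv_mul _ hu, one_mul]
  rw [hK, hpole, ← mul_smul_comm, ← mul_sub]
  simp only [W]
  congr 1
  ext i j
  simp only [Matrix.sub_apply, Matrix.add_apply, Matrix.smul_apply, vecMulVec_apply,
    Pi.add_apply, Pi.smul_apply, smul_eq_mul]
  field_simp
  ring

/-- The real symmetric case of `tendsto_inv_quadratic_pencil_sub_pole`, with `D` positive definite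
and `L` positive semidefinite of one-dimensional kernel. -/
theorem tendsto_inv_quadratic_pencil_sub_pole_of_posDef {k : ℕ} (M D L : Matrix (Fin k) (Fin k) ℝ)
    (hD : D.PosDef) (hL : L.PosSemidef) (v : Fin k → ℝ) (hv : v ≠ 0) (hLv : L *ᵥ v = 0)
    (hker : ∀ x, L *ᵥ x = 0 → ∃ a : ℝ, a • v = x) :
    ∃ E : Matrix (Fin k) (Fin k) ℂ,
      Tendsto (fun s : ℂ => (s ^ 2 • M.map (Complex.ofReal ·) + s • D.map (Complex.ofReal ·)
          + L.map (Complex.ofReal ·))⁻¹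
        - (s⁻¹ * ((v ⬝ᵥ D *ᵥ v : ℝ) : ℂ)⁻¹) • (vecMulVec v v).map (Complex.ofReal ·))
        (𝓝[≠] 0) (𝓝 E) := by
  have hDt : Dᵀ = D := hD.isHermitian.eq
  have hLt : Lᵀ = L := hL.isHermitian.eq
  have hc : 0 < v ⬝ᵥ D *ᵥ v := by simpa using hD.dotProduct_mulVec_pos hv
  have hdet : (L + vecMulVec (D *ᵥ v) (D *ᵥ v)).det ≠ 0 := by
    intro h
    obtain ⟨x, hx0, hx⟩ := Matrix.exists_mulVec_eq_zero_iff.mpr h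
    have hq := congrArg (x ⬝ᵥ ·) hx
    simp only [add_mulVec, vecMulVec_mulVec, dotProduct_add, op_smul_eq_smul, dotProduct_smul,
      dotProduct_zero, smul_eq_mul, dotProduct_comm x (D *ᵥ v)] at hq
    have hn : 0 ≤ x ⬝ᵥ L *ᵥ x := by simpa using hL.dotProduct_mulVec_nonneg x
    have hLx : x ⬝ᵥ L *ᵥ x = 0 := by nlinarith [mul_self_nonneg (D *ᵥ v ⬝ᵥ x)]
    have hwx : D *ᵥ v ⬝ᵥ x = 0 := by nlinarith
    obtain ⟨a, rfl⟩ := hker x ((hL.dotProduct_mulVec_zero_iff x).mp (by simpa using hLx))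
    rw [dotProduct_smul, dotProduct_comm, smul_eq_mul, mul_eq_zero] at hwx
    rcases hwx with rfl | h0
    · simp at hx0
    · exact hc.ne' h0
  have hmv (A : Matrix (Fin k) (Fin k) ℝ) :
      A.map (Complex.ofReal ·) *ᵥ (fun i => (v i : ℂ)) = fun i => ((A *ᵥ v) i : ℂ) :=
    funext fun i => (Complex.ofRealHom.map_mulVec A v i).symm
  have hvm (A : Matrix (Fin k) (Fin k) ℝ) :
      (fun i => (v i : ℂ)) ᵥ* A.map (Complex.ofReal ·) = fun i => ((v ᵥ* A) i : ℂ) :=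
    funext fun i => (Complex.ofRealHom.map_vecMul A v i).symm
  have hdot : (fun i => (v i : ℂ)) ⬝ᵥ D.map (Complex.ofReal ·) *ᵥ (fun i => (v i : ℂ))
      = ((v ⬝ᵥ D *ᵥ v : ℝ) : ℂ) := by
    rw [hmv]
    exact (Complex.ofRealHom.map_dotProduct v (D *ᵥ v)).symm
  have hvv (u : Fin k → ℝ) : vecMulVec (fun i => (u i : ℂ)) (fun i => (u i : ℂ))
      = (vecMulVec u u).map (Complex.ofReal ·) := by
    ext i j
    simp [vecMulVec_apply]
  have key := tendsto_inv_quadratic_pencil_sub_pole (M.map (Complex.ofReal ·))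
    (D.map (Complex.ofReal ·)) (L.map (Complex.ofReal ·)) (fun i => (v i : ℂ))
    (by rw [hmv, hvm, ← mulVec_transpose, hDt])
    (by rw [hmv, hLv]; ext; simp)
    (by rw [hvm, ← mulVec_transpose, hLt, hLv]; ext; simp)
    (by rw [hdot]; exact_mod_cast hc.ne')
    (by
      rw [hmv, hvv, ← Matrix.map_add _ Complex.ofReal_add]
      exact fun h => hdet (Complex.ofReal_eq_zero.mp ((Complex.ofRealHom.map_det _).trans h)))
  rwa [hdot, hvv] at key

/-- Under residue matching (`υ̂` in the column space of the orthonormal basis `V`),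
the error `E(s) = H(s) − H_r(s)` has a removable singularity at `s = 0`: it converges
to some matrix `E₀` as `s → 0`, `s ≠ 0`. -/
theorem stmt13 {n m q r : ℕ} (M D Lhat : Matrix (Fin n) (Fin n) ℝ)
    (hM : M.PosDef) (hD : D.PosDef) (hL : Lhat.PosSemidef)
    (vhat : Fin n → ℝ) (hv0 : vhat ≠ 0)
    (hker : LinearMap.ker Lhat.mulVecLin = Submodule.span ℝ {vhat})
    (B : Matrix (Fin n) (Fin m) ℝ) (C : Matrix (Fin q) (Fin n) ℝ)
    (V : Matrix (Fin n) (Fin r) ℝ) (hV : Vᵀ * V = (1 : Matrix (Fin r) (Fin r) ℝ))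
    (hrange : vhat ∈ LinearMap.range V.mulVecLin) :
    letI K : ℂ → Matrix (Fin n) (Fin n) ℂ := fun s =>
      s ^ 2 • M.map (Complex.ofReal ·) + s • D.map (Complex.ofReal ·)
        + Lhat.map (Complex.ofReal ·)
    letI H : ℂ → Matrix (Fin q) (Fin m) ℂ := fun s =>
      C.map (Complex.ofReal ·) * (K s)⁻¹ * B.map (Complex.ofReal ·)
    letI Kr : ℂ → Matrix (Fin r) (Fin r) ℂ := fun s =>
      s ^ 2 • (Vᵀ * M * V).map (Complex.ofReal ·) + s • (Vᵀ * D * V).map (Complex.ofReal ·)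
        + (Vᵀ * Lhat * V).map (Complex.ofReal ·)
    letI Hr : ℂ → Matrix (Fin q) (Fin m) ℂ := fun s =>
      (C * V).map (Complex.ofReal ·) * (Kr s)⁻¹ * (Vᵀ * B).map (Complex.ofReal ·)
    ∃ E₀ : Matrix (Fin q) (Fin m) ℂ,
      Tendsto (fun s : ℂ => H s - Hr s) (𝓝[≠] 0) (𝓝 E₀) := by
  beta_reduce
  obtain ⟨x, rfl⟩ := hrange
  rw [mulVecLin_apply] at hv0 hker
  have hinj (y z : Fin r → ℝ) (h : V *ᵥ y = V *ᵥ z) : y = z := by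
    simpa [mulVec_mulVec, hV] using congrArg (Vᵀ *ᵥ ·) h
  have hx0 : x ≠ 0 := by rintro rfl; simp at hv0
  have hmem (y : Fin n → ℝ) : Lhat *ᵥ y = 0 ↔ ∃ a : ℝ, a • V *ᵥ x = y := by
    rw [← Submodule.mem_span_singleton, ← hker, LinearMap.mem_ker, mulVecLin_apply]
  have hLv : Lhat *ᵥ V *ᵥ x = 0 := (hmem _).mpr ⟨1, one_smul _ _⟩
  have hDr : (Vᵀ * D * V).PosDef := by
    simpa using hD.conjTranspose_mul_mul_same (B := V) hinj
  have hLr : (Vᵀ * Lhat * V).PosSemidef := by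
    simpa using hL.conjTranspose_mul_mul_same V
  have hLrx : (Vᵀ * Lhat * V) *ᵥ x = 0 := by
    rw [← mulVec_mulVec, ← mulVec_mulVec, hLv, mulVec_zero]
  have hkr (y : Fin r → ℝ) (hy : (Vᵀ * Lhat * V) *ᵥ y = 0) : ∃ a : ℝ, a • x = y := by
    have h0 : star (V *ᵥ y) ⬝ᵥ Lhat *ᵥ V *ᵥ y = 0 := by
      have h1 := congrArg (y ⬝ᵥ ·) hy
      simpa [← mulVec_mulVec, dotProduct_mulVec, vecMul_transpose, ← vecMul_vecMul] using h1
    obtain ⟨a, ha⟩ := (hmem _).mp ((hL.dotProduct_mulVec_zero_iff _).mp h0)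
    exact ⟨a, hinj _ _ (by rw [mulVec_smul, ha])⟩
  obtain ⟨E, hE⟩ := tendsto_inv_quadratic_pencil_sub_pole_of_posDef M D Lhat hD hL (V *ᵥ x) hv0 hLv
    fun y hy => (hmem y).mp hy
  obtain ⟨F, hF⟩ := tendsto_inv_quadratic_pencil_sub_pole_of_posDef (Vᵀ * M * V) (Vᵀ * D * V)
    (Vᵀ * Lhat * V) hDr hLr x hx0 hLrx hkr
  have hc : x ⬝ᵥ (Vᵀ * D * V) *ᵥ x = (V *ᵥ x) ⬝ᵥ D *ᵥ V *ᵥ x := by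
    rw [← mulVec_mulVec, ← mulVec_mulVec, dotProduct_mulVec, vecMul_transpose]
  have hmap {a b d : ℕ} (X : Matrix (Fin a) (Fin b) ℝ) (Y : Matrix (Fin b) (Fin d) ℝ) :
      (X * Y).map (Complex.ofReal ·) = X.map (Complex.ofReal ·) * Y.map (Complex.ofReal ·) :=
    Matrix.map_mul (f := Complex.ofRealHom)
  have hres : (C * V).map (Complex.ofReal ·) * (vecMulVec x x).map (Complex.ofReal ·)
        * (Vᵀ * B).map (Complex.ofReal ·)
      = C.map (Complex.ofReal ·) * (vecMulVec (V *ᵥ x) (V *ᵥ x)).map (Complex.ofReal ·)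
        * B.map (Complex.ofReal ·) := by
    rw [← hmap, ← hmap, ← hmap, ← hmap]
    simp only [mul_vecMulVec, vecMulVec_mul, mulVec_mulVec, ← vecMul_vecMul, vecMul_transpose]
  rw [hc] at hF
  have hsandwich {k : ℕ} (X : Matrix (Fin q) (Fin k) ℂ) (Y : Matrix (Fin k) (Fin m) ℂ) :
      Continuous fun Z : Matrix (Fin k) (Fin k) ℂ => X * Z * Y := by fun_prop
  refine ⟨_, (((hsandwich (C.map (Complex.ofReal ·)) (B.map (Complex.ofReal ·))).tendsto E).comp
    hE).sub (((hsandwich ((C * V).map (Complex.ofReal ·)) ((Vᵀ * B).map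
      (Complex.ofReal ·))).tendsto F).comp hF) |>.congr fun s => ?_⟩
  simp only [Function.comp_apply, Matrix.mul_sub, Matrix.sub_mul, Matrix.mul_smul, Matrix.smul_mul, hres,
    sub_sub_sub_cancel_right]
end

section
/- (Corollary 1, H∞ bound) Let M and D be real symmetric positive definite n×n matrices, L̂ a real symmetric positive semidefinite n×n matrix whose kernel is the one-dimensional span of a nonzero vector υ̂ ∈ ℝⁿ, B ∈ ℝ^{n×m}, C ∈ ℝ^{q×n}, and let V be a real n×r matrix with orthonormal columns such that υ̂ lies in the column space of V. Then there exists a constant K such that for every real ω ≠ 0, ‖H(iω) − H_r(iω)‖ ≤ K; i.e. the error system has bounded H∞ norm. -/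
open Matrix Filter Topology

attribute [local instance] Matrix.frobeniusNormedAddCommGroup

theorem frobenius_norm_sq {k p : Type*} [Fintype k] [Fintype p] (X : Matrix k p ℂ) :
    ‖X‖ ^ 2 = ∑ i, ∑ j, ‖X i j‖ ^ 2 := by
  rw [frobenius_norm_def, ← Real.sqrt_eq_rpow, Real.sq_sqrt (by positivity)]
  simp

theorem norm_entry_le_frobenius_norm {k p : Type*} [Fintype k] [Fintype p]
    (X : Matrix k p ℂ) (i : k) (j : p) : ‖X i j‖ ≤ ‖X‖ := by
  refine (sq_le_sq₀ (norm_nonneg _) (norm_nonneg _)).mp ?_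
  rw [frobenius_norm_sq]
  exact (Finset.single_le_sum (f := fun j => ‖X i j‖ ^ 2) (fun _ _ => by positivity)
    (Finset.mem_univ j)).trans (Finset.single_le_sum (f := fun i => ∑ j, ‖X i j‖ ^ 2)
      (fun _ _ => by positivity) (Finset.mem_univ i))

theorem norm_trace_le {p : Type*} [Fintype p] (A : Matrix p p ℂ) :
    ‖A.trace‖ ≤ Fintype.card p * ‖A‖ := by
  refine (norm_sum_le _ _).trans ((Finset.sum_le_card_nsmul _ _ ‖A‖ fun i _ =>
    norm_entry_le_frobenius_norm A i i).trans ?_)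
  simp

theorem re_trace_conjTranspose_mul_self {k p : Type*} [Fintype k] [Fintype p]
    (X : Matrix k p ℂ) : (Xᴴ * X).trace.re = ‖X‖ ^ 2 := by
  rw [frobenius_norm_sq, Finset.sum_comm]
  simp [trace, mul_apply, Complex.sq_norm, Complex.normSq_apply]

theorem im_trace_eq_zero_of_isHermitian {p : Type*} [Fintype p] {A : Matrix p p ℂ}
    (hA : A.IsHermitian) : A.trace.im = 0 := by
  rw [← Complex.conj_eq_iff_im, starRingEnd_apply, ← trace_conjTranspose, hA.eq]

open scoped MatrixOrder in
theorem Matrix.PosDef.exists_isUnit_eq_transpose_mul_self {n : Type*} [Fintype n] [DecidableEq n]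
    {D : Matrix n n ℝ} (hD : D.PosDef) : ∃ E : Matrix n n ℝ, IsUnit E ∧ D = Eᵀ * E := by
  obtain ⟨E, hE⟩ := CStarAlgebra.nonneg_iff_eq_star_mul_self.mp hD.posSemidef.nonneg
  rw [star_eq_conjTranspose, conjTranspose_eq_transpose_of_trivial] at hE
  refine ⟨E, ?_, hE⟩
  have h := hD.isUnit
  rw [hE, isUnit_iff_isUnit_det, det_mul] at h
  exact (isUnit_iff_isUnit_det _).mpr (isUnit_of_mul_isUnit_right h)

/-- Energy identity for a damped quadratic pencil on the imaginary axis. -/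
theorem im_trace_quadratic_pencil {k p : Type*} [Fintype k] [Fintype p]
    {M L : Matrix k k ℂ} (E : Matrix k k ℂ) (hM : M.IsHermitian) (hL : L.IsHermitian)
    (ω : ℝ) (X : Matrix k p ℂ) :
    (Xᴴ * ((((ω : ℂ) * Complex.I) ^ 2 • M + ((ω : ℂ) * Complex.I) • (Eᴴ * E) + L) * X)).trace.im
      = ω * ‖E * X‖ ^ 2 := by
  have h1 := im_trace_eq_zero_of_isHermitian (isHermitian_conjTranspose_mul_mul X hM)
  have h2 := im_trace_eq_zero_of_isHermitian (isHermitian_conjTranspose_mul_mul X hL)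
  have h3 := im_trace_eq_zero_of_isHermitian (isHermitian_conjTranspose_mul_self (E * X))
  rw [← re_trace_conjTranspose_mul_self]
  simp only [conjTranspose_mul, Matrix.mul_assoc, Matrix.add_mul, Matrix.mul_add, trace_add,
    Matrix.smul_mul, Matrix.mul_smul, trace_smul] at *
  simp [h1, h2, h3, pow_two]

theorem frobenius_norm_smul {k p : Type*} [Fintype k] [Fintype p] (s : ℂ)
    (X : Matrix k p ℂ) : ‖s • X‖ = ‖s‖ * ‖X‖ :=
  letI := frobeniusNormSMulClass (m := k) (n := p) (R := ℂ) (α := ℂ)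
  norm_smul s X

theorem norm_le_norm_inv_mul_norm_mul {k p : Type*} [Fintype k] [DecidableEq k] [Fintype p]
    {E : Matrix k k ℂ} (hE : IsUnit E) (X : Matrix k p ℂ) : ‖X‖ ≤ ‖E⁻¹‖ * ‖E * X‖ := by
  rw [isUnit_iff_isUnit_det] at hE
  simpa [nonsing_inv_mul_cancel_left _ X hE] using frobenius_norm_mul E⁻¹ (E * X)

theorem isUnit_quadratic_pencil {k : Type*} [Fintype k] [DecidableEq k]
    {M L E : Matrix k k ℂ} (hM : M.IsHermitian) (hL : L.IsHermitian) (hE : IsUnit E)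
    {ω : ℝ} (hω : ω ≠ 0) :
    IsUnit (((ω : ℂ) * Complex.I) ^ 2 • M + ((ω : ℂ) * Complex.I) • (Eᴴ * E) + L) := by
  rw [isUnit_iff_isUnit_det, isUnit_iff_ne_zero, ne_eq, ← exists_mulVec_eq_zero_iff]
  rintro ⟨v, hv, h⟩
  have h1 := im_trace_quadratic_pencil E hM hL ω (replicateCol (Fin 1) v)
  rw [← replicateCol_mulVec, h] at h1
  have h2 : ‖E * replicateCol (Fin 1) v‖ = 0 := by simpa [hω] using h1
  have h3 := norm_le_norm_inv_mul_norm_mul hE (replicateCol (Fin 1) v)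
  rw [h2, mul_zero, norm_le_zero_iff] at h3
  exact hv (replicateCol_injective (ι := Fin 1) (h3.trans replicateCol_zero.symm))

theorem abs_mul_norm_inv_quadratic_pencil_le {k : Type*} [Fintype k] [DecidableEq k]
    {M L E : Matrix k k ℂ} (hM : M.IsHermitian) (hL : L.IsHermitian) (hE : IsUnit E)
    {ω : ℝ} (hω : ω ≠ 0) :
    |ω| * ‖(((ω : ℂ) * Complex.I) ^ 2 • M + ((ω : ℂ) * Complex.I) • (Eᴴ * E) + L)⁻¹‖
      ≤ ‖E⁻¹‖ ^ 2 * Fintype.card k := by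
  have hS := isUnit_quadratic_pencil hM hL hE hω
  have h := im_trace_quadratic_pencil E hM hL ω
    (((ω : ℂ) * Complex.I) ^ 2 • M + ((ω : ℂ) * Complex.I) • (Eᴴ * E) + L)⁻¹
  set S := ((ω : ℂ) * Complex.I) ^ 2 • M + ((ω : ℂ) * Complex.I) • (Eᴴ * E) + L
  rw [mul_nonsing_inv _ ((isUnit_iff_isUnit_det _).mp hS), Matrix.mul_one] at h
  have h1 : |ω| * ‖E * S⁻¹‖ ^ 2 ≤ Fintype.card k * ‖S⁻¹‖ := by
    calc |ω| * ‖E * S⁻¹‖ ^ 2 = |(S⁻¹)ᴴ.trace.im| := by rw [h, abs_mul, abs_sq]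
      _ ≤ ‖(S⁻¹)ᴴ.trace‖ := Complex.abs_im_le_norm _
      _ ≤ Fintype.card k * ‖(S⁻¹)ᴴ‖ := norm_trace_le _
      _ = Fintype.card k * ‖S⁻¹‖ := by rw [frobenius_norm_conjTranspose]
  have h2 := norm_le_norm_inv_mul_norm_mul hE S⁻¹
  rcases (norm_nonneg S⁻¹).eq_or_lt with h0 | h0
  · rw [← h0, mul_zero]
    positivity
  · refine le_of_mul_le_mul_right ?_ h0
    calc |ω| * ‖S⁻¹‖ * ‖S⁻¹‖ = |ω| * ‖S⁻¹‖ ^ 2 := by ring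
      _ ≤ |ω| * (‖E⁻¹‖ * ‖E * S⁻¹‖) ^ 2 := by gcongr
      _ = ‖E⁻¹‖ ^ 2 * (|ω| * ‖E * S⁻¹‖ ^ 2) := by ring
      _ ≤ ‖E⁻¹‖ ^ 2 * (Fintype.card k * ‖S⁻¹‖) := by gcongr
      _ = ‖E⁻¹‖ ^ 2 * Fintype.card k * ‖S⁻¹‖ := by ring

theorem map_ofReal_mul {k l p : Type*} [Fintype l] (A : Matrix k l ℝ) (B : Matrix l p ℝ) :
    (A * B).map (Complex.ofReal ·) = A.map (Complex.ofReal ·) * B.map (Complex.ofReal ·) :=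
  Matrix.map_mul (f := Complex.ofRealHom)

theorem conjTranspose_map_ofReal {k l : Type*} (A : Matrix k l ℝ) :
    (A.map (Complex.ofReal ·))ᴴ = Aᵀ.map (Complex.ofReal ·) := by
  ext i j
  simp

theorem isHermitian_map_ofReal {k : Type*} {A : Matrix k k ℝ} (hA : A.IsHermitian) :
    (A.map (Complex.ofReal ·)).IsHermitian := by
  rw [IsHermitian, conjTranspose_map_ofReal, ← conjTranspose_eq_transpose_of_trivial, hA.eq]

/-- The residue at `s = 0` of `(s² M + s D + L)⁻¹` when `ker L` is spanned by `v`. -/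
noncomputable def poleResidue {k : Type*} [Fintype k] (D : Matrix k k ℝ) (v : k → ℝ) :
    Matrix k k ℝ :=
  (v ⬝ᵥ D *ᵥ v)⁻¹ • vecMulVec v v

/-- The complementary projection `1 - D R` has range in the range of `L`. -/
theorem exists_mul_eq_one_sub_mul_poleResidue {k : Type*} [Fintype k] [DecidableEq k]
    {D L : Matrix k k ℝ} (hD : D.PosDef) (hL : L.PosSemidef) {v : k → ℝ} (hv : v ≠ 0)
    (hLv : ∀ x, L *ᵥ x = 0 ↔ ∃ c : ℝ, c • v = x) :
    ∃ Y : Matrix k k ℝ, L * Y = 1 - D * poleResidue D v := by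
  have hvv : v ⬝ᵥ v ≠ 0 := by simpa using hv
  have hDv : v ⬝ᵥ D *ᵥ v ≠ 0 := by simpa using (hD.dotProduct_mulVec_pos hv).ne'
  have hLv0 : L *ᵥ v = 0 := (hLv v).mpr ⟨1, one_smul _ _⟩
  have hQ : (vecMulVec v v).PosSemidef := by simpa using posSemidef_vecMulVec_self_star v
  have hP : (L + vecMulVec v v).PosDef := by
    refine .of_dotProduct_mulVec_pos (hL.add hQ).isHermitian fun x hx => ?_
    refine ((hL.add hQ).dotProduct_mulVec_nonneg x).lt_of_ne' fun h0 => hx ?_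
    have h1 := hL.dotProduct_mulVec_nonneg x
    have h2 := hQ.dotProduct_mulVec_nonneg x
    rw [add_mulVec, dotProduct_add] at h0
    have h3 := (hL.dotProduct_mulVec_zero_iff x).mp (by linarith)
    have h4 := (hQ.dotProduct_mulVec_zero_iff x).mp (by linarith)
    obtain ⟨c, rfl⟩ := (hLv x).mp h3
    simpa [vecMulVec_mulVec, hv] using h4
  have hPu := (isUnit_iff_isUnit_det _).mp hP.isUnit
  set P := L + vecMulVec v v with hPdef
  have hvL : v ᵥ* L = 0 := by
    rw [← hLv0, ← vecMul_transpose, ← conjTranspose_eq_transpose_of_trivial, hL.isHermitian.eq]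
  have hvP : v ᵥ* P⁻¹ = (v ⬝ᵥ v)⁻¹ • v := by
    have h1 : v ᵥ* P = (v ⬝ᵥ v) • v := by
      rw [hPdef, vecMul_add, hvL, zero_add, vecMul_vecMulVec]
    have h2 : v ᵥ* P ᵥ* P⁻¹ = v := by rw [vecMul_vecMul, mul_nonsing_inv _ hPu, vecMul_one]
    rw [h1, smul_vecMul] at h2
    rw [eq_inv_smul_iff₀ hvv, h2]
  have hDt : Dᵀ = D := by rw [← conjTranspose_eq_transpose_of_trivial, hD.isHermitian.eq]
  have hvD : v ᵥ* (1 - D * poleResidue D v) = 0 := by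
    have : v ᵥ* D = D *ᵥ v := by rw [← hDt, vecMul_transpose, hDt]
    rw [vecMul_sub, vecMul_one, ← vecMul_vecMul, poleResidue, vecMul_smul, vecMul_vecMulVec,
      ← dotProduct_mulVec, inv_smul_smul₀ hDv, sub_self]
  refine ⟨P⁻¹ * (1 - D * poleResidue D v), ?_⟩
  have hL' : L = P - vecMulVec v v := by rw [hPdef, add_sub_cancel_right]
  rw [hL', Matrix.sub_mul, mul_nonsing_inv_cancel_left _ _ hPu, vecMulVec_mul, ← vecMul_vecMul,
    hvP, smul_vecMul, hvD, smul_zero, vecMulVec_zero, sub_zero]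

theorem exists_norm_inv_quadratic_pencil_sub_le {k : Type*} [Fintype k] [DecidableEq k]
    {M D L : Matrix k k ℝ} (hM : M.PosDef) (hD : D.PosDef) (hL : L.PosSemidef)
    {v : k → ℝ} (hv : v ≠ 0) (hLv : ∀ x, L *ᵥ x = 0 ↔ ∃ c : ℝ, c • v = x) :
    ∃ K : ℝ, ∀ ω : ℝ, ω ≠ 0 →
      ‖(((ω : ℂ) * Complex.I) ^ 2 • M.map (Complex.ofReal ·)
          + ((ω : ℂ) * Complex.I) • D.map (Complex.ofReal ·) + L.map (Complex.ofReal ·))⁻¹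
        - ((ω : ℂ) * Complex.I)⁻¹ • (poleResidue D v).map (Complex.ofReal ·)‖ ≤ K := by
  obtain ⟨Y, hY⟩ := exists_mul_eq_one_sub_mul_poleResidue hD hL hv hLv
  obtain ⟨E, hE, hDE⟩ := hD.exists_isUnit_eq_transpose_mul_self
  have hE' : IsUnit (E.map (Complex.ofReal ·)) := hE.map Complex.ofRealHom.mapMatrix
  have hDE' : D.map (Complex.ofReal ·)
      = (E.map (Complex.ofReal ·))ᴴ * E.map (Complex.ofReal ·) := by
    rw [conjTranspose_map_ofReal, ← map_ofReal_mul, hDE]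
  have hM' := isHermitian_map_ofReal hM.isHermitian
  have hL' := isHermitian_map_ofReal hL.isHermitian
  have hLR : L * poleResidue D v = 0 := by
    rw [poleResidue, Matrix.mul_smul, mul_vecMulVec, (hLv v).mpr ⟨1, one_smul _ _⟩,
      zero_vecMulVec, smul_zero]
  have hY' : L.map (Complex.ofReal ·) * Y.map (Complex.ofReal ·)
      = 1 - D.map (Complex.ofReal ·) * (poleResidue D v).map (Complex.ofReal ·) := by
    rw [← map_ofReal_mul, ← map_ofReal_mul, hY]
    ext i j
    simp [one_apply, apply_ite]
  have hLR' : L.map (Complex.ofReal ·) * (poleResidue D v).map (Complex.ofReal ·) = 0 := by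
    rw [← map_ofReal_mul, hLR]
    ext i j
    simp
  generalize M.map (Complex.ofReal ·) = M at *
  generalize D.map (Complex.ofReal ·) = D' at *
  generalize L.map (Complex.ofReal ·) = L at *
  generalize E.map (Complex.ofReal ·) = E at *
  generalize Y.map (Complex.ofReal ·) = Y at *
  generalize (poleResidue D v).map (Complex.ofReal ·) = R at *
  subst hDE'
  set D := Eᴴ * E
  set c : ℝ := ‖E⁻¹‖ ^ 2 * Fintype.card k
  refine ⟨max (‖Y‖ + c * (‖M * Y‖ + ‖D * Y + M * R‖)) (c + ‖R‖), fun ω hω => ?_⟩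
  have hS := (isUnit_iff_isUnit_det _).mp (isUnit_quadratic_pencil hM' hL' hE' hω)
  have hc := abs_mul_norm_inv_quadratic_pencil_le hM' hL' hE' hω
  have hs : (ω : ℂ) * Complex.I ≠ 0 := by simp [hω]
  have hsn : ‖(ω : ℂ) * Complex.I‖ = |ω| := by simp
  generalize (ω : ℂ) * Complex.I = s at *
  set S := s ^ 2 • M + s • D + L with hSdef
  rcases le_total |ω| 1 with h1 | h1
  · refine le_max_of_le_left ?_
    have key : S⁻¹ - s⁻¹ • R = Y - s • (S⁻¹ * (s • (M * Y) + (D * Y + M * R))) := by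
      have : S * (S⁻¹ - s⁻¹ • R)
          = S * (Y - s • (S⁻¹ * (s • (M * Y) + (D * Y + M * R)))) := by
        rw [Matrix.mul_sub, Matrix.mul_sub, mul_nonsing_inv _ hS, Matrix.mul_smul,
          Matrix.mul_smul, mul_nonsing_inv_cancel_left _ _ hS]
        simp only [hSdef, Matrix.add_mul, Matrix.smul_mul, hY', hLR', smul_add, smul_smul,
          add_zero]
        rw [show s⁻¹ * s ^ 2 = s by field_simp, inv_mul_cancel₀ hs, pow_two]
        module
      simpa [nonsing_inv_mul_cancel_left _ _ hS] using congrArg (S⁻¹ * ·) this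
    rw [key]
    refine (norm_sub_le _ _).trans (add_le_add_right ?_ _)
    calc ‖s • (S⁻¹ * (s • (M * Y) + (D * Y + M * R)))‖
        = |ω| * ‖S⁻¹ * (s • (M * Y) + (D * Y + M * R))‖ := by
          rw [← hsn]; exact frobenius_norm_smul s _
      _ ≤ |ω| * (‖S⁻¹‖ * ‖s • (M * Y) + (D * Y + M * R)‖) := by
          gcongr; exact frobenius_norm_mul _ _
      _ = |ω| * ‖S⁻¹‖ * ‖s • (M * Y) + (D * Y + M * R)‖ := by ring
      _ ≤ c * (‖M * Y‖ + ‖D * Y + M * R‖) := by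
          gcongr
          refine (norm_add_le _ _).trans ?_
          gcongr
          rw [frobenius_norm_smul, hsn]
          exact mul_le_of_le_one_left (norm_nonneg _) h1
  · refine le_max_of_le_right ((norm_sub_le _ _).trans (add_le_add ?_ ?_))
    · exact (le_mul_of_one_le_left (norm_nonneg _) h1).trans hc
    · rw [frobenius_norm_smul, norm_inv, hsn]
      exact mul_le_of_le_one_left (norm_nonneg _) (inv_le_one_of_one_le₀ h1)

/-- (Corollary 1, H∞ bound) Under residue matching, the error system is uniformly
bounded on the imaginary axis: there is `K` with `‖H(iω) − H_r(iω)‖ ≤ K` for all real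
`ω ≠ 0` (Frobenius norm). -/
theorem stmt14 {n m q r : ℕ} (M D Lhat : Matrix (Fin n) (Fin n) ℝ)
    (hM : M.PosDef) (hD : D.PosDef) (hL : Lhat.PosSemidef)
    (vhat : Fin n → ℝ) (hv0 : vhat ≠ 0)
    (hker : LinearMap.ker Lhat.mulVecLin = Submodule.span ℝ {vhat})
    (B : Matrix (Fin n) (Fin m) ℝ) (C : Matrix (Fin q) (Fin n) ℝ)
    (V : Matrix (Fin n) (Fin r) ℝ) (hV : Vᵀ * V = (1 : Matrix (Fin r) (Fin r) ℝ))
    (hrange : vhat ∈ LinearMap.range V.mulVecLin) :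
    letI K : ℂ → Matrix (Fin n) (Fin n) ℂ := fun s =>
      s ^ 2 • M.map (Complex.ofReal ·) + s • D.map (Complex.ofReal ·)
        + Lhat.map (Complex.ofReal ·)
    letI H : ℂ → Matrix (Fin q) (Fin m) ℂ := fun s =>
      C.map (Complex.ofReal ·) * (K s)⁻¹ * B.map (Complex.ofReal ·)
    letI Kr : ℂ → Matrix (Fin r) (Fin r) ℂ := fun s =>
      s ^ 2 • (Vᵀ * M * V).map (Complex.ofReal ·) + s • (Vᵀ * D * V).map (Complex.ofReal ·)
        + (Vᵀ * Lhat * V).map (Complex.ofReal ·)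
    letI Hr : ℂ → Matrix (Fin q) (Fin m) ℂ := fun s =>
      (C * V).map (Complex.ofReal ·) * (Kr s)⁻¹ * (Vᵀ * B).map (Complex.ofReal ·)
    ∃ Kbound : ℝ, ∀ ω : ℝ, ω ≠ 0 →
      ‖H ((ω : ℂ) * Complex.I) - Hr ((ω : ℂ) * Complex.I)‖ ≤ Kbound := by
  have hVt : ∀ x, V *ᵥ x = 0 → x = 0 := fun x hx => by
    rw [← one_mulVec x, ← hV, ← mulVec_mulVec, hx, mulVec_zero]
  have hVinj : Function.Injective V.mulVec := fun x y hxy =>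
    sub_eq_zero.mp (hVt _ (by rw [mulVec_sub, hxy, sub_self]))
  have hLv : ∀ x, Lhat *ᵥ x = 0 ↔ ∃ c : ℝ, c • vhat = x := fun x => by
    rw [← Submodule.mem_span_singleton, ← hker]
    simp
  obtain ⟨w, rfl⟩ := hrange
  rw [mulVecLin_apply] at hv0 hLv
  have hw : w ≠ 0 := fun h => hv0 (by rw [h, mulVec_zero])
  have hM' : (Vᵀ * M * V).PosDef := by
    simpa using hM.conjTranspose_mul_mul_same hVinj
  have hD' : (Vᵀ * D * V).PosDef := by
    simpa using hD.conjTranspose_mul_mul_same hVinj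
  have hL' : (Vᵀ * Lhat * V).PosSemidef := by
    simpa using hL.conjTranspose_mul_mul_same V
  have hconj : ∀ (A : Matrix (Fin n) (Fin n) ℝ) (x : Fin r → ℝ),
      x ⬝ᵥ (Vᵀ * A * V) *ᵥ x = (V *ᵥ x) ⬝ᵥ A *ᵥ (V *ᵥ x) := fun A x => by
    rw [← mulVec_mulVec, ← mulVec_mulVec, dotProduct_mulVec, vecMul_transpose]
  have hLw : ∀ x, (Vᵀ * Lhat * V) *ᵥ x = 0 ↔ ∃ c : ℝ, c • w = x := fun x => by
    have h1 := hL'.dotProduct_mulVec_zero_iff x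
    have h2 := hL.dotProduct_mulVec_zero_iff (V *ᵥ x)
    rw [star_trivial] at h1 h2
    rw [← h1, hconj, h2, hLv]
    simp only [← mulVec_smul, hVinj.eq_iff]
  have hres : poleResidue D (V *ᵥ w) = V * poleResidue (Vᵀ * D * V) w * Vᵀ := by
    rw [poleResidue, poleResidue, hconj, Matrix.mul_smul, Matrix.smul_mul, mul_vecMulVec,
      vecMulVec_mul, vecMul_transpose]
  obtain ⟨K₁, hK₁⟩ := exists_norm_inv_quadratic_pencil_sub_le hM hD hL hv0 hLv
  obtain ⟨K₂, hK₂⟩ := exists_norm_inv_quadratic_pencil_sub_le hM' hD' hL' hw hLw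
  refine ⟨‖C.map (Complex.ofReal ·)‖ * K₁ * ‖B.map (Complex.ofReal ·)‖
    + ‖(C * V).map (Complex.ofReal ·)‖ * K₂ * ‖(Vᵀ * B).map (Complex.ofReal ·)‖,
    fun ω hω => ?_⟩
  have hsplit : ∀ (s : ℂ) (X : Matrix (Fin n) (Fin n) ℂ) (Y : Matrix (Fin r) (Fin r) ℂ),
      C.map (Complex.ofReal ·) * X * B.map (Complex.ofReal ·)
        - (C * V).map (Complex.ofReal ·) * Y * (Vᵀ * B).map (Complex.ofReal ·)
      = C.map (Complex.ofReal ·)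
          * (X - s⁻¹ • (poleResidue D (V *ᵥ w)).map (Complex.ofReal ·))
          * B.map (Complex.ofReal ·)
        - (C * V).map (Complex.ofReal ·)
          * (Y - s⁻¹ • (poleResidue (Vᵀ * D * V) w).map (Complex.ofReal ·))
          * (Vᵀ * B).map (Complex.ofReal ·) := fun s X Y => by
    simp only [hres, map_ofReal_mul, Matrix.mul_sub, Matrix.sub_mul, Matrix.mul_smul,
      Matrix.smul_mul, Matrix.mul_assoc]
    abel
  beta_reduce
  rw [hsplit ((ω : ℂ) * Complex.I)]
  refine (norm_sub_le _ _).trans (add_le_add ?_ ?_)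
  · refine (frobenius_norm_mul _ _).trans (mul_le_mul_of_nonneg_right ?_ (norm_nonneg _))
    exact (frobenius_norm_mul _ _).trans (mul_le_mul_of_nonneg_left (hK₁ ω hω) (norm_nonneg _))
  · refine (frobenius_norm_mul _ _).trans (mul_le_mul_of_nonneg_right ?_ (norm_nonneg _))
    exact (frobenius_norm_mul _ _).trans (mul_le_mul_of_nonneg_left (hK₂ ω hω) (norm_nonneg _))
end

section
/- (Tangential interpolation by Galerkin projection) Let M, D, L̂ be complex n×n matrices, B ∈ ℂ^{n×m}, C ∈ ℂ^{q×n}, and define 𝒦(s) = s²M + sD + L̂. Let σ ∈ ℂ and b ∈ ℂ^m be such that 𝒦(σ) is invertible, and let V ∈ ℂ^{n×r} be a matrix such that 𝒦_r(σ) := Vᵀ𝒦(σ)V is invertible and the vector 𝒦(σ)⁻¹Bb lies in the column space of V. Then the Galerkin-reduced transfer function interpolates the full one at (σ, b): CV 𝒦_r(σ)⁻¹ VᵀBb = C 𝒦(σ)⁻¹ Bb, i.e. H_r(σ)b = H(σ)b. -/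
open Matrix

/-- (Tangential interpolation by Galerkin projection) If `𝒦(σ) = σ²M + σD + L̂` is
invertible, the reduced matrix `Vᵀ𝒦(σ)V` is invertible, and `𝒦(σ)⁻¹Bb` lies in the
column space of `V`, then the reduced transfer function tangentially interpolates the
full one at `(σ, b)`: `H_r(σ)b = H(σ)b`. -/
theorem stmt18 {n m q r : ℕ} (M D Lhat : Matrix (Fin n) (Fin n) ℂ)
    (B : Matrix (Fin n) (Fin m) ℂ) (C : Matrix (Fin q) (Fin n) ℂ)
    (σ : ℂ) (b : Fin m → ℂ) (V : Matrix (Fin n) (Fin r) ℂ)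
    (hK : IsUnit (σ ^ 2 • M + σ • D + Lhat))
    (hKr : IsUnit (Vᵀ * (σ ^ 2 • M + σ • D + Lhat) * V))
    (hb : (σ ^ 2 • M + σ • D + Lhat)⁻¹.mulVec (B.mulVec b)
        ∈ LinearMap.range V.mulVecLin) :
    ((C * V) * (Vᵀ * (σ ^ 2 • M + σ • D + Lhat) * V)⁻¹ * (Vᵀ * B)).mulVec b
      = (C * (σ ^ 2 • M + σ • D + Lhat)⁻¹ * B).mulVec b := by
  obtain ⟨y, hy⟩ := hb
  rw [mulVecLin_apply] at hy
  generalize σ ^ 2 • M + σ • D + Lhat = K at *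
  have hBb : B *ᵥ b = K *ᵥ (V *ᵥ y) := by
    rw [hy, mulVec_mulVec, mul_nonsing_inv _ ((isUnit_iff_isUnit_det _).mp hK), one_mulVec]
  have hred : (Vᵀ * B) *ᵥ b = (Vᵀ * K * V) *ᵥ y := by
    simp only [← mulVec_mulVec, hBb]
  calc
    (C * V * (Vᵀ * K * V)⁻¹ * (Vᵀ * B)) *ᵥ b
        = (C * V) *ᵥ ((Vᵀ * K * V)⁻¹ *ᵥ ((Vᵀ * K * V) *ᵥ y)) := by
      rw [← mulVec_mulVec, hred, ← mulVec_mulVec]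
    _ = C *ᵥ (V *ᵥ y) := by
      rw [mulVec_mulVec y (Vᵀ * K * V)⁻¹,
        nonsing_inv_mul _ ((isUnit_iff_isUnit_det _).mp hKr), one_mulVec, mulVec_mulVec]
    _ = (C * K⁻¹ * B) *ᵥ b := by
      rw [hy, ← mulVec_mulVec, ← mulVec_mulVec]
end
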